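/- arXiv:2505.15583 — 3 statements merged into one kernel-verified Lean document; each statement's English description precedes it below -/
import Mathlib

section
/- Let m ≥ 2 and let p be an integer with 1 ≤ p and 2p ≤ m+1, and set J_p = diag(−1, I_{2p−1}, −I_{m+2−2p}) ∈ M_{m+2}(ℝ). Then the fixed-point set {X ∈ p₀ : J_p X J_p = X} equals the ℝ-span of the set {E_{1k} + E_{k1} : 2p+1 ≤ k ≤ m+2} ∪ {E_{2r} + E_{r2} : 3 ≤ r ≤ 2p} in M_{m+2}(ℝ); in particular this fixed-point set has dimension m. -/
open Matrix

/-- The elementary matrix `E_{ij}` (1-based indices) of size `n × n`. -/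
def Emat (n i j : ℕ) : Matrix (Fin n) (Fin n) ℝ :=
  Matrix.of fun a b => if (a : ℕ) + 1 = i ∧ (b : ℕ) + 1 = j then 1 else 0

/-- `p₀`: real `(2+m) × (2+m)` matrices of the form `[[0, X₂],[X₂ᵀ, 0]]`. -/
def p0 (m : ℕ) : Set (Matrix (Fin (2 + m)) (Fin (2 + m)) ℝ) :=
  {X | ∃ X₂ : Matrix (Fin 2) (Fin m) ℝ,
      X = Matrix.reindex finSumFinEquiv finSumFinEquiv (Matrix.fromBlocks 0 X₂ X₂ᵀ 0)}

/-- The linear embedding `X ↦ [[0, X], [Xᵀ, 0]]`, whose range is `p₀`. -/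
def offDiagEmbedding (m : ℕ) :
    Matrix (Fin 2) (Fin m) ℝ →ₗ[ℝ] Matrix (Fin (2 + m)) (Fin (2 + m)) ℝ where
  toFun X := Matrix.reindex finSumFinEquiv finSumFinEquiv (Matrix.fromBlocks 0 X Xᵀ 0)
  map_add' X Y := by
    rw [← (Matrix.reindex finSumFinEquiv finSumFinEquiv).symm.injective.eq_iff]
    ext (i | i) (j | j) <;> simp
  map_smul' c X := by
    rw [← (Matrix.reindex finSumFinEquiv finSumFinEquiv).symm.injective.eq_iff]
    ext (i | i) (j | j) <;> simp

@[simp]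
lemma offDiagEmbedding_castAdd_castAdd {m : ℕ} (X : Matrix (Fin 2) (Fin m) ℝ) (i j : Fin 2) :
    offDiagEmbedding m X (Fin.castAdd m i) (Fin.castAdd m j) = 0 := by
  simp [offDiagEmbedding]

@[simp]
lemma offDiagEmbedding_castAdd_natAdd {m : ℕ} (X : Matrix (Fin 2) (Fin m) ℝ)
    (i : Fin 2) (j : Fin m) :
    offDiagEmbedding m X (Fin.castAdd m i) (Fin.natAdd 2 j) = X i j := by
  simp [offDiagEmbedding]

@[simp]
lemma offDiagEmbedding_natAdd_castAdd {m : ℕ} (X : Matrix (Fin 2) (Fin m) ℝ)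
    (i : Fin m) (j : Fin 2) :
    offDiagEmbedding m X (Fin.natAdd 2 i) (Fin.castAdd m j) = X j i := by
  simp [offDiagEmbedding]

@[simp]
lemma offDiagEmbedding_natAdd_natAdd {m : ℕ} (X : Matrix (Fin 2) (Fin m) ℝ) (i j : Fin m) :
    offDiagEmbedding m X (Fin.natAdd 2 i) (Fin.natAdd 2 j) = 0 := by
  simp [offDiagEmbedding]

lemma mem_p0_iff {m : ℕ} {X : Matrix (Fin (2 + m)) (Fin (2 + m)) ℝ} :
    X ∈ p0 m ↔ ∃ Y, X = offDiagEmbedding m Y := Iff.rfl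

lemma matrix_ext_castAdd_natAdd {m : ℕ} {A B : Matrix (Fin (2 + m)) (Fin (2 + m)) ℝ}
    (h₁₁ : ∀ i j, A (Fin.castAdd m i) (Fin.castAdd m j) = B (Fin.castAdd m i) (Fin.castAdd m j))
    (h₁₂ : ∀ i j, A (Fin.castAdd m i) (Fin.natAdd 2 j) = B (Fin.castAdd m i) (Fin.natAdd 2 j))
    (h₂₁ : ∀ i j, A (Fin.natAdd 2 i) (Fin.castAdd m j) = B (Fin.natAdd 2 i) (Fin.castAdd m j))
    (h₂₂ : ∀ i j, A (Fin.natAdd 2 i) (Fin.natAdd 2 j) = B (Fin.natAdd 2 i) (Fin.natAdd 2 j)) :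
    A = B := by
  ext a b
  refine Fin.addCases (fun i => ?_) (fun i => ?_) a <;>
    refine Fin.addCases (fun j => ?_) (fun j => ?_) b
  exacts [h₁₁ i j, h₁₂ i j, h₂₁ i j, h₂₂ i j]

lemma offDiagEmbedding_injective (m : ℕ) : Function.Injective (offDiagEmbedding m) := by
  intro X Y h
  ext i j
  simpa using congrFun (congrFun h (Fin.castAdd m i)) (Fin.natAdd 2 j)

lemma offDiagEmbedding_single {m : ℕ} (i : Fin 2) (j : Fin m) :
    offDiagEmbedding m (Matrix.single i j 1) =
      Emat (2 + m) (i + 1) (j + 3) + Emat (2 + m) (j + 3) (i + 1) := by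
  apply matrix_ext_castAdd_natAdd <;> intro a b <;>
    simp [Emat, Matrix.single_apply, Fin.ext_iff] <;> grind

lemma diagonal_mul_offDiagEmbedding_mul_diagonal {m : ℕ} (d : Fin (2 + m) → ℝ)
    (X : Matrix (Fin 2) (Fin m) ℝ) :
    Matrix.diagonal d * offDiagEmbedding m X * Matrix.diagonal d =
      offDiagEmbedding m
        (Matrix.of fun i j => d (Fin.castAdd m i) * d (Fin.natAdd 2 j) * X i j) := by
  apply matrix_ext_castAdd_natAdd <;> intro a b <;> simp <;> ring

/-- The row of the `2 × m` block in which the `j`-th column of a `τ_p`-fixed matrix is supported. -/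
def fixedRow (m p : ℕ) (j : Fin m) : Fin 2 := if (j : ℕ) + 2 < 2 * p then 1 else 0

/-- The generators of the fixed-point set, indexed by the columns of the `2 × m` block. -/
def fixedGenerator (m p : ℕ) (j : Fin m) : Matrix (Fin (2 + m)) (Fin (2 + m)) ℝ :=
  offDiagEmbedding m (Matrix.single (fixedRow m p j) j 1)

lemma sum_smul_fixedGenerator {m : ℕ} (p : ℕ) (c : Fin m → ℝ) :
    ∑ j, c j • fixedGenerator m p j =
      offDiagEmbedding m (Matrix.of fun i j => if i = fixedRow m p j then c j else 0) := by
  simp only [fixedGenerator, ← map_smul, ← map_sum]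
  congr 1
  ext i j
  rw [Matrix.sum_apply, Finset.sum_eq_single j]
  · simp [Matrix.single_apply, eq_comm]
  · intro k _ hk
    simp [hk]
  · simp

lemma linearIndependent_fixedGenerator (m p : ℕ) :
    LinearIndependent ℝ (fixedGenerator m p) := by
  rw [Fintype.linearIndependent_iff]
  intro c hc j
  rw [sum_smul_fixedGenerator, map_eq_zero_iff _ (offDiagEmbedding_injective m)] at hc
  simpa using congrFun (congrFun hc (fixedRow m p j)) j

lemma range_fixedGenerator {m p : ℕ} (hp1 : 1 ≤ p) (hpm : 2 * p ≤ m + 1) :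
    Set.range (fixedGenerator m p) =
      {A | (∃ k, 2 * p + 1 ≤ k ∧ k ≤ m + 2 ∧ A = Emat (2 + m) 1 k + Emat (2 + m) k 1) ∨
           (∃ r, 3 ≤ r ∧ r ≤ 2 * p ∧ A = Emat (2 + m) 2 r + Emat (2 + m) r 2)} := by
  ext A
  simp only [Set.mem_range, Set.mem_ofPred_eq, fixedGenerator, offDiagEmbedding_single, fixedRow]
  constructor
  · rintro ⟨j, rfl⟩
    by_cases h : (j : ℕ) + 2 < 2 * p
    · exact Or.inr ⟨j + 3, by omega, by omega, by simp [h]⟩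
    · exact Or.inl ⟨j + 3, by omega, by omega, by simp [h]⟩
  · rintro (⟨k, hk, hkm, rfl⟩ | ⟨r, hr, hrp, rfl⟩)
    · refine ⟨⟨k - 3, by omega⟩, ?_⟩
      rw [if_neg (by simp only; omega)]
      simp [show k - 3 + 3 = k by omega]
    · refine ⟨⟨r - 3, by omega⟩, ?_⟩
      rw [if_pos (by simp only; omega)]
      simp [show r - 3 + 3 = r by omega]

/-- the fixed-point set of `X ↦ J_p X J_p` on `p₀`, where
`J_p = diag(-1, I_{2p-1}, -I_{m+2-2p})`, is the `ℝ`-span of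
`{E_{1k} + E_{k1} : 2p+1 ≤ k ≤ m+2} ∪ {E_{2r} + E_{r2} : 3 ≤ r ≤ 2p}`,
which has dimension `m`. -/
theorem fixed_points_of_tau_p_on_p0 (m p : ℕ) (hm : 2 ≤ m) (hp1 : 1 ≤ p)
    (hpm : 2 * p ≤ m + 1) :
    let n := 2 + m
    let Jp : Matrix (Fin n) (Fin n) ℝ :=
      Matrix.diagonal fun i =>
        if (i : ℕ) = 0 then -1 else if (i : ℕ) < 2 * p then 1 else -1
    let S : Set (Matrix (Fin n) (Fin n) ℝ) :=
      {A | (∃ k, 2 * p + 1 ≤ k ∧ k ≤ m + 2 ∧ A = Emat n 1 k + Emat n k 1) ∨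
           (∃ r, 3 ≤ r ∧ r ≤ 2 * p ∧ A = Emat n 2 r + Emat n r 2)}
    {X | X ∈ p0 m ∧ Jp * X * Jp = X} = (Submodule.span ℝ S : Set _) ∧
    Module.finrank ℝ ↥(Submodule.span ℝ S) = m := by
  intro n Jp S
  have hS : S = Set.range (fixedGenerator m p) := (range_fixedGenerator hp1 hpm).symm
  rw [hS, finrank_span_eq_card (linearIndependent_fixedGenerator m p)]
  refine ⟨?_, Fintype.card_fin m⟩
  ext X
  simp only [Set.mem_ofPred_eq, SetLike.mem_coe, Submodule.mem_span_range_iff_exists_fun,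
    sum_smul_fixedGenerator, mem_p0_iff]
  constructor
  · rintro ⟨⟨Y, rfl⟩, hY⟩
    rw [diagonal_mul_offDiagEmbedding_mul_diagonal,
      (offDiagEmbedding_injective m).eq_iff] at hY
    refine ⟨fun j => Y (fixedRow m p j) j, congrArg _ ?_⟩
    ext i j
    have h := congrFun (congrFun hY i) j
    fin_cases i <;> simp [fixedRow] at h ⊢ <;> grind
  · rintro ⟨c, rfl⟩
    refine ⟨⟨_, rfl⟩, ?_⟩
    rw [diagonal_mul_offDiagEmbedding_mul_diagonal]
    congr 1
    ext i j
    fin_cases i <;> simp [fixedRow] <;> grind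
end

section
/- Let m ≥ 2 and let p be an integer with 1 ≤ p and 2p ≤ m+1, and set J_p = diag(−1, I_{2p−1}, −I_{m+2−2p}) ∈ M_{m+2}(ℝ). Let K = {diag(A, B) ∈ M_{m+2}(ℝ) : A ∈ SO(2), B ∈ SO(m)}. Then {k ∈ K : J_p k J_p = k} = {diag(A, X, Y) : A ∈ {I_2, −I_2}, X ∈ O(2p−2), Y ∈ O(m+2−2p), det(X)·det(Y) = 1}, where diag(A, X, Y) denotes the block-diagonal matrix with diagonal blocks A, X, Y (the block X being absent when p = 1). -/
open Matrix

/-- The orthogonal group `O(n)` as a set of matrices. -/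
def Ogrp (n : ℕ) : Set (Matrix (Fin n) (Fin n) ℝ) := {A | Aᵀ * A = 1}

/-- The special orthogonal group `SO(n)` as a set of matrices. -/
def SOgrp (n : ℕ) : Set (Matrix (Fin n) (Fin n) ℝ) := {A | Aᵀ * A = 1 ∧ A.det = 1}

/-- Conjugation by a diagonal matrix scales entries. -/
lemma diagonal_mul_mul_diagonal_eq_self_iff {ι : Type*} [Fintype ι] [DecidableEq ι]
    (d : ι → ℝ) (k : Matrix ι ι ℝ) :
    diagonal d * k * diagonal d = k ↔ ∀ i j, d i * k i j * d j = k i j := by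
  simp [← Matrix.ext_iff, mul_diagonal, diagonal_mul]

lemma eq_one_or_neg_one_of_mem_SOgrp_two {A : Matrix (Fin 2) (Fin 2) ℝ} (hA : A ∈ SOgrp 2)
    (h01 : A 0 1 = 0) (h10 : A 1 0 = 0) : A = 1 ∨ A = -1 := by
  obtain ⟨hO, hdet⟩ := hA
  have h00 := congrFun (congrFun hO 0) 0
  simp only [mul_apply, transpose_apply, Fin.sum_univ_two, h10, one_apply_eq, mul_zero,
    add_zero] at h00
  rw [det_fin_two, h01, zero_mul, sub_zero] at hdet
  rcases mul_self_eq_one_iff.mp h00 with h | h <;> rw [h] at hdet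
  · left
    ext i j
    fin_cases i <;> fin_cases j <;> simp [h, h01, h10]
    linarith
  · right
    ext i j
    fin_cases i <;> fin_cases j <;> simp [h, h01, h10]
    linarith

lemma one_or_neg_one_mem_SOgrp_two {A : Matrix (Fin 2) (Fin 2) ℝ} (hA : A = 1 ∨ A = -1) :
    A ∈ SOgrp 2 ∧ A 0 1 = 0 ∧ A 1 0 = 0 := by
  rcases hA with rfl | rfl <;> simp [SOgrp, det_neg]

/-- A reindexed block-diagonal matrix is in `SO(m)` exactly when its blocks are orthogonal with
inverse determinants. -/
lemma reindex_fromBlocks_mem_SOgrp_iff {a b m : ℕ} (f : Fin a ⊕ Fin b ≃ Fin m)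
    (X : Matrix (Fin a) (Fin a) ℝ) (Y : Matrix (Fin b) (Fin b) ℝ) :
    reindex f f (fromBlocks X 0 0 Y) ∈ SOgrp m ↔
      X ∈ Ogrp a ∧ Y ∈ Ogrp b ∧ X.det * Y.det = 1 := by
  have h1 : (1 : Matrix (Fin m) (Fin m) ℝ) = reindex f f 1 := by simp
  simp only [SOgrp, Ogrp, Set.mem_ofPred_eq, det_reindex_self, det_fromBlocks_zero₂₁,
    transpose_reindex]
  rw [h1, reindex_apply, reindex_apply, submatrix_mul_equiv, ← reindex_apply,
    (reindex f f).injective.eq_iff, fromBlocks_transpose, fromBlocks_multiply, ← fromBlocks_one,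
    fromBlocks_inj]
  simp [and_assoc]

/-- the fixed-point subgroup of conjugation by
`J_p = diag(-1, I_{2p-1}, -I_{m+2-2p})` inside `K = {diag(A,B) : A ∈ SO(2), B ∈ SO(m)}`
is `{diag(A, X, Y) : A = ±I₂, X ∈ O(2p-2), Y ∈ O(m+2-2p), det X · det Y = 1}`. -/
theorem fixed_subgroup_K_tau_p (m p : ℕ) (hm : 2 ≤ m) (hp1 : 1 ≤ p)
    (hpm : 2 * p ≤ m + 1) :
    let n := 2 + m
    let Jp : Matrix (Fin n) (Fin n) ℝ :=
      Matrix.diagonal fun i =>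
        if (i : ℕ) = 0 then -1 else if (i : ℕ) < 2 * p then 1 else -1
    let e : Fin 2 ⊕ (Fin (2 * p - 2) ⊕ Fin (m + 2 - 2 * p)) ≃ Fin n :=
      (Equiv.sumCongr (Equiv.refl (Fin 2)) finSumFinEquiv).trans
        (finSumFinEquiv.trans (finCongr (by omega)))
    {k : Matrix (Fin n) (Fin n) ℝ |
        (∃ A ∈ SOgrp 2, ∃ B ∈ SOgrp m,
          k = Matrix.reindex finSumFinEquiv finSumFinEquiv (Matrix.fromBlocks A 0 0 B)) ∧
        Jp * k * Jp = k} =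
      {k | ∃ (A : Matrix (Fin 2) (Fin 2) ℝ) (X : Matrix (Fin (2 * p - 2)) (Fin (2 * p - 2)) ℝ)
            (Y : Matrix (Fin (m + 2 - 2 * p)) (Fin (m + 2 - 2 * p)) ℝ),
          (A = 1 ∨ A = -1) ∧ X ∈ Ogrp (2 * p - 2) ∧ Y ∈ Ogrp (m + 2 - 2 * p) ∧
          X.det * Y.det = 1 ∧
          k = Matrix.reindex e e (Matrix.fromBlocks A 0 0 (Matrix.fromBlocks X 0 0 Y))} := by
  intro n Jp e
  let f : Fin (2 * p - 2) ⊕ Fin (m + 2 - 2 * p) ≃ Fin m :=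
    finSumFinEquiv.trans (finCongr (by omega))
  have he : e = (Equiv.sumCongr (Equiv.refl (Fin 2)) f).trans finSumFinEquiv := by
    ext x
    rcases x with x | x | x <;> simp [e, f]
  have hblocks : ∀ (A : Matrix (Fin 2) (Fin 2) ℝ)
      (C : Matrix (Fin (2 * p - 2) ⊕ Fin (m + 2 - 2 * p)) _ ℝ),
      reindex e e (fromBlocks A 0 0 C) =
        reindex finSumFinEquiv finSumFinEquiv (fromBlocks A 0 0 (reindex f f C)) := by
    intro A C
    rw [he]
    ext i j
    obtain ⟨i, rfl⟩ := finSumFinEquiv.surjective i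
    obtain ⟨j, rfl⟩ := finSumFinEquiv.surjective j
    rcases i with i | i <;> rcases j with j | j <;>
      simp [-finSumFinEquiv_apply_left, -finSumFinEquiv_apply_right]
  have hfix : ∀ (A : Matrix (Fin 2) (Fin 2) ℝ)
      (C : Matrix (Fin (2 * p - 2) ⊕ Fin (m + 2 - 2 * p)) _ ℝ),
      Jp * reindex e e (fromBlocks A 0 0 C) * Jp = reindex e e (fromBlocks A 0 0 C) ↔
        (A 0 1 = 0 ∧ A 1 0 = 0) ∧ C.toBlocks₁₂ = 0 ∧ C.toBlocks₂₁ = 0 := by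
    intro A C
    have hsign : ∀ x, (if ((e x : Fin n) : ℕ) = 0 then (-1 : ℝ)
        else if ((e x : Fin n) : ℕ) < 2 * p then 1 else -1) =
        Sum.elim ![-1, 1] (Sum.elim (fun _ => 1) (fun _ => -1)) x := by
      rintro (x | x | x)
      · fin_cases x
        · simp [e]
        · simp [e]
          omega
      · have hlt : 2 + (x : ℕ) < 2 * p := by omega
        simp [e, -Fin.val_eq_zero_iff, hlt]
      · have hge : ¬ 2 + (2 * p - 2 + (x : ℕ)) < 2 * p := by omega
        simp [e, -Fin.val_eq_zero_iff, hge]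
    have hneg : ∀ r : ℝ, -r = r ↔ r = 0 := fun r => by constructor <;> intro h <;> linarith
    rw [diagonal_mul_mul_diagonal_eq_self_iff, ← e.forall_congr_right]
    simp_rw [← e.forall_congr_right (q := fun j => _ = reindex e e _ _ j), hsign]
    simp [hneg, ← Matrix.ext_iff, toBlocks₁₂, toBlocks₂₁, Fin.forall_fin_two, forall_and]
    tauto
  ext k
  constructor
  · rintro ⟨⟨A, hA, B, hB, rfl⟩, hJ⟩
    obtain ⟨C, rfl⟩ := (reindex f f).surjective B
    rw [← hblocks, hfix] at hJ
    obtain ⟨⟨h01, h10⟩, h12, h21⟩ := hJ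
    have hC : C = fromBlocks C.toBlocks₁₁ 0 0 C.toBlocks₂₂ := by
      rw [← h12, ← h21, fromBlocks_toBlocks]
    rw [hC, reindex_fromBlocks_mem_SOgrp_iff] at hB
    refine ⟨A, C.toBlocks₁₁, C.toBlocks₂₂, eq_one_or_neg_one_of_mem_SOgrp_two hA h01 h10,
      hB.1, hB.2.1, hB.2.2, ?_⟩
    rw [← hC, hblocks]
  · rintro ⟨A, X, Y, hA, hX, hY, hdet, rfl⟩
    obtain ⟨hA, hA0⟩ := one_or_neg_one_mem_SOgrp_two hA
    exact ⟨⟨A, hA, _, (reindex_fromBlocks_mem_SOgrp_iff f X Y).2 ⟨hX, hY, hdet⟩, hblocks _ _⟩,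
      (hfix _ _).2 ⟨hA0, by simp, by simp⟩⟩
end

section
/- Let l ≥ 3, m = 2l−2, and 1 ≤ p ≤ l−2. Set J_p = diag(−1, I_{2p−1}, −I_{2l−2p}) ∈ M_{2l}(ℝ) and let V_p be the ℝ-span of {E_{1k} + E_{k1} : 2p+1 ≤ k ≤ 2l} ∪ {E_{2r} + E_{r2} : 3 ≤ r ≤ 2p} in M_{2l}(ℝ). Then for every matrix k of the form diag(A, B) with A ∈ SO(2) and B ∈ SO(2l−2) satisfying J_p k J_p = k, the linear map X ↦ k X k⁻¹ maps V_p into V_p and its restriction to V_p has determinant 1. -/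
open Matrix

/-- If `φ` restricted to the range `V` of an injective linear map `T` is intertwined by `T` with an
endomorphism `D`, then `φ` preserves `V` and acts on it with determinant `det D`. -/
theorem LinearMap.det_restrict_of_intertwining {E F : Type*} [AddCommGroup E] [Module ℝ E]
    [AddCommGroup F] [Module ℝ F] (T : E →ₗ[ℝ] F) (hT : Function.Injective T)
    (V : Submodule ℝ F) (hr : LinearMap.range T = V) (φ : F →ₗ[ℝ] F) (D : E →ₗ[ℝ] E)
    (h : ∀ v, φ (T v) = T (D v)) :
    ∃ hV : ∀ x ∈ V, φ x ∈ V, LinearMap.det (φ.restrict hV) = LinearMap.det D := by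
  subst hr
  have hV : ∀ x ∈ LinearMap.range T, φ x ∈ LinearMap.range T := by
    rintro _ ⟨v, rfl⟩
    exact ⟨D v, (h v).symm⟩
  refine ⟨hV, ?_⟩
  rw [← LinearMap.det_conj D (LinearEquiv.ofInjective T hT)]
  congr 1
  ext ⟨_, v, rfl⟩
  have hv : (LinearEquiv.ofInjective T hT).symm ⟨T v, v, rfl⟩ = v :=
    (LinearEquiv.ofInjective T hT).symm_apply_eq.2 rfl
  simp [hv, h]

/-- The symmetric off-diagonal block matrix whose entry in column `j` of the upper right block is
`v j`, placed in row `s j`. -/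
def symmOffDiag {κ N : Type*} (e : Fin 2 ⊕ κ ≃ N) (s : κ → Fin 2) :
    (κ → ℝ) →ₗ[ℝ] Matrix N N ℝ where
  toFun v := (fromBlocks 0 (of fun i j => if i = s j then v j else 0)
    (of fun j i => if i = s j then v j else 0) 0).submatrix e.symm e.symm
  map_add' v w := by
    ext x y
    rcases h : e.symm x with i | i <;> rcases h' : e.symm y with j | j <;>
      simp [h, h', ite_add_ite]
  map_smul' c v := by
    ext x y
    rcases h : e.symm x with i | i <;> rcases h' : e.symm y with j | j <;> simp [h, h']

theorem symmOffDiag_injective {κ N : Type*} (e : Fin 2 ⊕ κ ≃ N) (s : κ → Fin 2) :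
    Function.Injective (symmOffDiag e s) := by
  intro v w h
  ext j
  simpa [symmOffDiag] using congrFun (congrFun h (e (.inl (s j)))) (e (.inr j))

theorem conj_symmOffDiag {κ N : Type*} [Fintype κ] [DecidableEq κ] [Fintype N] [DecidableEq N]
    (e : Fin 2 ⊕ κ ≃ N) (s : κ → Fin 2) (a : ℝ) (ha : a * a = 1) (B : Matrix κ κ ℝ)
    (hB : Bᵀ * B = 1) (hs : ∀ i j, s i ≠ s j → B i j = 0) (v : κ → ℝ) :
    (fromBlocks (a • (1 : Matrix (Fin 2) (Fin 2) ℝ)) 0 0 B).submatrix e.symm e.symm *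
        symmOffDiag e s v *
        ((fromBlocks (a • (1 : Matrix (Fin 2) (Fin 2) ℝ)) 0 0 B).submatrix e.symm e.symm)⁻¹ =
      symmOffDiag e s ((a • B) *ᵥ v) := by
  have hinv : (fromBlocks (a • (1 : Matrix (Fin 2) (Fin 2) ℝ)) 0 0 B)⁻¹ =
      fromBlocks (a • (1 : Matrix (Fin 2) (Fin 2) ℝ)) 0 0 Bᵀ := by
    apply inv_eq_left_inv
    simp [fromBlocks_multiply, hB, smul_smul, ha]
  have hsum : ∀ (w : κ → ℝ) i j, (∑ x, if i = s x then w x * B j x else 0) =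
      if i = s j then ∑ x, w x * B j x else 0 := by
    intro w i j
    split_ifs with hi
    · refine Finset.sum_congr rfl fun x _ => ?_
      split_ifs with hx
      · rfl
      · rw [hs j x (by rwa [← hi]), mul_zero]
    · refine Finset.sum_eq_zero fun x _ => ?_
      split_ifs with hx
      · rw [hs j x (by rw [← hx]; exact Ne.symm hi), mul_zero]
      · rfl
  have hmul : ∀ j, ((a • B) *ᵥ v) j = a * ∑ x, v x * B j x := by
    intro j
    simp [mulVec, dotProduct, Finset.mul_sum, mul_comm, mul_left_comm]
  rw [inv_submatrix_equiv, hinv]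
  simp only [symmOffDiag, LinearMap.coe_mk, AddHom.coe_mk, submatrix_mul_equiv,
    fromBlocks_multiply]
  congr 2
  · simp
  · ext i j
    simpa [mul_apply, hmul, Finset.mul_sum, mul_assoc] using hsum (fun x => a * v x) i j
  · ext j i
    simp [mul_apply, mul_comm (B _ _), hsum, hmul, mul_comm a]
  · simp

theorem range_symmOffDiag {κ N : Type*} [Fintype κ] [DecidableEq κ] (e : Fin 2 ⊕ κ ≃ N)
    (s : κ → Fin 2) :
    LinearMap.range (symmOffDiag e s) =
      Submodule.span ℝ (Set.range fun j => symmOffDiag e s (Pi.single j 1)) := by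
  rw [LinearMap.range_eq_map, ← (Pi.basisFun ℝ κ).span_eq, Submodule.map_span, ← Set.range_comp]
  congr 2
  ext1 j
  simp

theorem eq_smul_one_of_mem_SOgrp_two {A : Matrix (Fin 2) (Fin 2) ℝ} (hA : A ∈ SOgrp 2)
    (h01 : A 0 1 = 0) (h10 : A 1 0 = 0) : A 0 0 * A 0 0 = 1 ∧ A = A 0 0 • 1 := by
  obtain ⟨hA1, hA2⟩ := hA
  have h00 : A 0 0 * A 0 0 = 1 := by
    simpa [mul_apply, Fin.sum_univ_two, h10] using congrFun (congrFun hA1 0) 0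
  have hd : A 0 0 * A 1 1 = 1 := by simpa [det_fin_two, h01] using hA2
  have h11 : A 1 1 = A 0 0 := by linear_combination A 0 0 * hd - A 1 1 * h00
  refine ⟨h00, ?_⟩
  ext i j
  fin_cases i <;> fin_cases j <;> simp [h01, h10, h11]

/-- for `m = 2l-2`, `1 ≤ p ≤ l-2`, each element `k = diag(A,B)` (with
`A ∈ SO(2)`, `B ∈ SO(2l-2)`) fixed by conjugation with `J_p = diag(-1, I_{2p-1}, -I_{2l-2p})`
acts on `V_p` (the `ℝ`-span of `{E_{1k}+E_{k1} : 2p+1 ≤ k ≤ 2l} ∪ {E_{2r}+E_{r2} : 3 ≤ r ≤ 2p}`)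
by `X ↦ k X k⁻¹` with determinant `1` (orientation-preserving action). -/
theorem conj_action_orientation_preserving (l p : ℕ) (hl : 3 ≤ l) (hp1 : 1 ≤ p)
    (hpl : p ≤ l - 2) :
    let n := 2 * l
    let Jp : Matrix (Fin n) (Fin n) ℝ :=
      Matrix.diagonal fun i =>
        if (i : ℕ) = 0 then -1 else if (i : ℕ) < 2 * p then 1 else -1
    let Vp : Submodule ℝ (Matrix (Fin n) (Fin n) ℝ) :=
      Submodule.span ℝ
        {A | (∃ k, 2 * p + 1 ≤ k ∧ k ≤ 2 * l ∧ A = Emat n 1 k + Emat n k 1) ∨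
             (∃ r, 3 ≤ r ∧ r ≤ 2 * p ∧ A = Emat n 2 r + Emat n r 2)}
    ∀ k : Matrix (Fin n) (Fin n) ℝ,
      (∃ A ∈ SOgrp 2, ∃ B ∈ SOgrp (2 * l - 2),
        k = Matrix.reindex (finSumFinEquiv.trans (finCongr (by omega)))
              (finSumFinEquiv.trans (finCongr (by omega))) (Matrix.fromBlocks A 0 0 B)) →
      Jp * k * Jp = k →
      let φ : Matrix (Fin n) (Fin n) ℝ →ₗ[ℝ] Matrix (Fin n) (Fin n) ℝ :=
        (LinearMap.mulRight ℝ k⁻¹).comp (LinearMap.mulLeft ℝ k)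
      ∃ hV : ∀ x ∈ Vp, φ x ∈ Vp, LinearMap.det (φ.restrict hV) = 1 := by
  intro n Jp Vp k ⟨A, hA, B, hB, hk⟩ hJ φ
  set e : Fin 2 ⊕ Fin (2 * l - 2) ≃ Fin n := finSumFinEquiv.trans (finCongr (by omega)) with he
  have hinl : ∀ i, (e (.inl i) : ℕ) = i := fun i => by simp [he]
  have hinr : ∀ j, (e (.inr j) : ℕ) = 2 + j := fun j => by simp [he]
  replace hk : k = (fromBlocks A 0 0 B).submatrix e.symm e.symm := hk
  have hent : ∀ x y, (if (e x : ℕ) = 0 then -1 else if (e x : ℕ) < 2 * p then 1 else -1) *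
      fromBlocks A 0 0 B x y *
      (if (e y : ℕ) = 0 then -1 else if (e y : ℕ) < 2 * p then 1 else -1) =
      fromBlocks A 0 0 B x y := by
    intro x y
    have h := congrFun (congrFun hJ (e x)) (e y)
    simpa only [Jp, mul_diagonal, diagonal_mul, hk, submatrix_apply, Equiv.symm_apply_apply] using h
  have h1p : 1 < 2 * p := by omega
  have h01 : A 0 1 = 0 := by
    have h := hent (.inl 0) (.inl 1)
    simp [hinl, h1p] at h
    linarith
  have h10 : A 1 0 = 0 := by
    have h := hent (.inl 1) (.inl 0)
    simp [hinl, h1p] at h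
    linarith
  obtain ⟨ha, hAa⟩ := eq_smul_one_of_mem_SOgrp_two hA h01 h10
  let s : Fin (2 * l - 2) → Fin 2 := fun j => if 2 + (j : ℕ) < 2 * p then 1 else 0
  have hs : ∀ i j, s i ≠ s j → B i j = 0 := by
    intro i j hij
    have h := hent (.inr i) (.inr j)
    by_cases hi : 2 + (i : ℕ) < 2 * p <;> by_cases hj : 2 + (j : ℕ) < 2 * p <;>
      simp [hinr, s, hi, hj] at h hij <;> linarith
  have hgen : ∀ j, symmOffDiag e s (Pi.single j 1) =
      Emat n (s j + 1) (j + 3) + Emat n (j + 3) (s j + 1) := by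
    intro j
    ext x y
    obtain ⟨x, rfl⟩ := e.surjective x
    obtain ⟨y, rfl⟩ := e.surjective y
    rcases x with x | x <;> rcases y with y | y <;>
      simp [symmOffDiag, Emat, hinl, hinr, Pi.single_apply, Fin.ext_iff] <;> grind
  have hr : LinearMap.range (symmOffDiag e s) = Vp := by
    rw [range_symmOffDiag]
    congr 1
    ext X
    simp only [Set.mem_range, Set.mem_ofPred_eq, hgen]
    constructor
    · rintro ⟨j, rfl⟩
      have hj := j.isLt
      by_cases h : 2 + (j : ℕ) < 2 * p
      · exact .inr ⟨j + 3, by omega, by omega, by simp [s, h]⟩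
      · exact .inl ⟨j + 3, by omega, by omega, by simp [s, h]⟩
    · rintro (⟨r, h1, h2, rfl⟩ | ⟨r, h1, h2, rfl⟩)
      · refine ⟨⟨r - 3, by omega⟩, ?_⟩
        have h : ¬ 2 + (r - 3) < 2 * p := by omega
        have h3 : r - 3 + 3 = r := by omega
        simp [s, h, h3]
      · refine ⟨⟨r - 3, by omega⟩, ?_⟩
        have h : 2 + (r - 3) < 2 * p := by omega
        have h3 : r - 3 + 3 = r := by omega
        simp [s, h, h3]
  obtain ⟨hV, hdet⟩ := LinearMap.det_restrict_of_intertwining (symmOffDiag e s)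
    (symmOffDiag_injective e s) Vp hr φ (Matrix.toLin' (A 0 0 • B)) (by
      intro v
      have h := conj_symmOffDiag e s (A 0 0) ha B hB.1 hs v
      rw [← hAa, ← hk] at h
      simpa only [φ, LinearMap.comp_apply, LinearMap.mulLeft_apply, LinearMap.mulRight_apply,
        toLin'_apply] using h)
  refine ⟨hV, ?_⟩
  have hpow : 2 * l - 2 = 2 * (l - 1) := by omega
  rw [hdet, LinearMap.det_toLin', det_smul, hB.2, Fintype.card_fin, hpow, pow_mul, sq, ha, one_pow,
    one_mul]
end
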